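/- (Braid relation with the thick strand at an end.) In R_{m+2}(Q̄_{C̃}), for all i, j ∈ I: (a) with E := e((μ̄,i,j)) times the copy of e_{λ_k} on strand positions 1,…,m, one has ψ_1 (ψ_2⋯ψ_{m+1}) (ψ_1⋯ψ_m) E = (ψ_2⋯ψ_{m+1}) (ψ_1⋯ψ_m) ψ_{m+1} E; and (b) with E' := e((j,i,μ̄)) times the copy of e_{λ_k} on strand positions 3,…,m+2, one has ψ_{m+1} (ψ_m⋯ψ_1) (ψ_{m+1}⋯ψ_2) E' = (ψ_m⋯ψ_1) (ψ_{m+1}⋯ψ_2) ψ_1 E'. Here (ψ_p⋯ψ_q) denotes the ordered product ψ_pψ_{p+1}⋯ψ_q when p ≤ q and ψ_pψ_{p−1}⋯ψ_q when p ≥ q. -/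

import Mathlib

open Classical
open scoped BigOperators

noncomputable section

/-- A Cartan datum on a finite index set `I`: a symmetric bilinear form with
`i·i ∈ 2ℤ_{>0}` and `2(i·j)/(i·i)` a nonpositive integer for `i ≠ j`. -/
structure CartanDatum (I : Type) [Fintype I] where
  form : I → I → ℤ
  symm : ∀ i j, form i j = form j i
  diag_even : ∀ i, Even (form i i)
  diag_pos : ∀ i, 0 < form i i
  off_dvd : ∀ i j, i ≠ j → form i i ∣ 2 * form i j
  off_nonpos : ∀ i j, i ≠ j → 2 * form i j ≤ 0

/-- The bilinear form of the extended Cartan datum on `Ĩ = I ⊔ Ī`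
(`Sum.inl` is `I`, `Sum.inr` is `Ī`). -/
def extForm {I : Type} [Fintype I] (C : CartanDatum I) : I ⊕ I → I ⊕ I → ℤ
  | Sum.inl i, Sum.inl j => C.form i j
  | Sum.inl i, Sum.inr j => if j = i then -(C.form i i / 2) else 0
  | Sum.inr i, Sum.inl j => if j = i then -(C.form i i / 2) else 0
  | Sum.inr i, Sum.inr j => if i = j then C.form i i else 0

/-- Generators of the KLR algebra on `n` strands labelled by `J`:
idempotents `e 𝐢`, dots `x j`, crossings `psi j` (crossing strands `j, j+1`, 0-indexed). -/
inductive KLRGen (J : Type) (n : ℕ) : Type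
  | e : (Fin n → J) → KLRGen J n
  | x : Fin n → KLRGen J n
  | psi : Fin (n - 1) → KLRGen J n

/-- The left strand position of the crossing `ψ_j`. -/
def lpos {n : ℕ} (j : Fin (n - 1)) : Fin n := Fin.castLE (n.sub_le 1) j

/-- The right strand position of the crossing `ψ_j`. -/
def rpos {n : ℕ} (j : Fin (n - 1)) : Fin n :=
  ⟨j.val + 1, by have := j.isLt; omega⟩

/-- The generator `e(𝐢)` of the free algebra. -/
def Ef (𝕜 : Type) [Field 𝕜] (J : Type) (n : ℕ) (i : Fin n → J) :
    FreeAlgebra 𝕜 (KLRGen J n) :=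
  FreeAlgebra.ι 𝕜 (KLRGen.e i)

/-- The generator `x_j` of the free algebra. -/
def Xf (𝕜 : Type) [Field 𝕜] (J : Type) (n : ℕ) (j : Fin n) :
    FreeAlgebra 𝕜 (KLRGen J n) :=
  FreeAlgebra.ι 𝕜 (KLRGen.x j)

/-- The generator `ψ_j` of the free algebra. -/
def Pf (𝕜 : Type) [Field 𝕜] (J : Type) (n : ℕ) (j : Fin (n - 1)) :
    FreeAlgebra 𝕜 (KLRGen J n) :=
  FreeAlgebra.ι 𝕜 (KLRGen.psi j)

/-- The Cartan integer `c(a,b) = 2(a·b)/(a·a)`. -/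
def cB {J : Type} (B : J → J → ℤ) (a b : J) : ℤ := 2 * B a b / B a a

/-- A bound such that any `p` with `s^{pq}(a,b) ≠ 0` satisfies `p < sBound B a b`. -/
def sBound {J : Type} (B : J → J → ℤ) (a b : J) : ℕ := (-(B a b)).toNat + 1

/-- The term `Σ_{p,q} s^{pq}(a,b) x_j^p x_{j'}^q`. -/
def psiSqS (𝕜 : Type) [Field 𝕜] (J : Type) (n : ℕ) (B : J → J → ℤ)
    (s : J → J → ℕ → ℕ → 𝕜) (a b : J) (j j' : Fin n) :
    FreeAlgebra 𝕜 (KLRGen J n) :=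
  ∑ p ∈ Finset.range (sBound B a b), ∑ q ∈ Finset.range (sBound B a b),
    s a b p q • (Xf 𝕜 J n j ^ p * Xf 𝕜 J n j' ^ q)

/-- The defining relations of the KLR algebra `R_n` associated with the form `B`
and scalar parameters `t`, `r`, `s`. -/
inductive KLRRel (𝕜 : Type) [Field 𝕜] (J : Type) [Fintype J] (n : ℕ)
    (B : J → J → ℤ) (t : J → J → 𝕜) (r : J → 𝕜) (s : J → J → ℕ → ℕ → 𝕜) :
    FreeAlgebra 𝕜 (KLRGen J n) → FreeAlgebra 𝕜 (KLRGen J n) → Prop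
  | ee (i j : Fin n → J) :
      KLRRel 𝕜 J n B t r s (Ef 𝕜 J n i * Ef 𝕜 J n j)
        (if i = j then Ef 𝕜 J n i else 0)
  | esum :
      KLRRel 𝕜 J n B t r s (∑ i : Fin n → J, Ef 𝕜 J n i) 1
  | xe (j : Fin n) (i : Fin n → J) :
      KLRRel 𝕜 J n B t r s (Xf 𝕜 J n j * Ef 𝕜 J n i) (Ef 𝕜 J n i * Xf 𝕜 J n j)
  | psie (j : Fin (n - 1)) (i : Fin n → J) :
      KLRRel 𝕜 J n B t r s (Pf 𝕜 J n j * Ef 𝕜 J n i)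
        (Ef 𝕜 J n (i ∘ Equiv.swap (lpos j) (rpos j)) * Pf 𝕜 J n j)
  | xx (j k : Fin n) :
      KLRRel 𝕜 J n B t r s (Xf 𝕜 J n j * Xf 𝕜 J n k) (Xf 𝕜 J n k * Xf 𝕜 J n j)
  | psix (j : Fin (n - 1)) (k : Fin n) (h1 : k ≠ lpos j) (h2 : k ≠ rpos j) :
      KLRRel 𝕜 J n B t r s (Pf 𝕜 J n j * Xf 𝕜 J n k) (Xf 𝕜 J n k * Pf 𝕜 J n j)
  | psipsi (j k : Fin (n - 1)) (h : (j : ℕ) + 1 < (k : ℕ)) :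
      KLRRel 𝕜 J n B t r s (Pf 𝕜 J n j * Pf 𝕜 J n k) (Pf 𝕜 J n k * Pf 𝕜 J n j)
  | dot1 (j : Fin (n - 1)) (i : Fin n → J) :
      KLRRel 𝕜 J n B t r s
        (Xf 𝕜 J n (lpos j) * Pf 𝕜 J n j * Ef 𝕜 J n i
          - Pf 𝕜 J n j * Xf 𝕜 J n (rpos j) * Ef 𝕜 J n i)
        (if i (lpos j) = i (rpos j) then r (i (lpos j)) • Ef 𝕜 J n i else 0)
  | dot2 (j : Fin (n - 1)) (i : Fin n → J) :
      KLRRel 𝕜 J n B t r s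
        (Pf 𝕜 J n j * Xf 𝕜 J n (lpos j) * Ef 𝕜 J n i
          - Xf 𝕜 J n (rpos j) * Pf 𝕜 J n j * Ef 𝕜 J n i)
        (if i (lpos j) = i (rpos j) then r (i (lpos j)) • Ef 𝕜 J n i else 0)
  | psisq (j : Fin (n - 1)) (i : Fin n → J) :
      KLRRel 𝕜 J n B t r s (Pf 𝕜 J n j * Pf 𝕜 J n j * Ef 𝕜 J n i)
        (if i (lpos j) = i (rpos j) then 0
         else if B (i (lpos j)) (i (rpos j)) = 0 then
           t (i (lpos j)) (i (rpos j)) • Ef 𝕜 J n i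
         else
           (t (i (lpos j)) (i (rpos j)) •
              (Xf 𝕜 J n (lpos j) ^ (-(cB B (i (lpos j)) (i (rpos j)))).toNat)
            + t (i (rpos j)) (i (lpos j)) •
              (Xf 𝕜 J n (rpos j) ^ (-(cB B (i (rpos j)) (i (lpos j)))).toNat)
            + psiSqS 𝕜 J n B s (i (lpos j)) (i (rpos j)) (lpos j) (rpos j))
           * Ef 𝕜 J n i)
  | braid (j k : Fin (n - 1)) (h : (j : ℕ) + 1 = (k : ℕ)) (i : Fin n → J) :
      KLRRel 𝕜 J n B t r s
        (Pf 𝕜 J n j * Pf 𝕜 J n k * Pf 𝕜 J n j * Ef 𝕜 J n i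
          - Pf 𝕜 J n k * Pf 𝕜 J n j * Pf 𝕜 J n k * Ef 𝕜 J n i)
        (if i (lpos j) = i (rpos k) ∧ cB B (i (lpos j)) (i (rpos j)) + 1 ≤ 0 then
          (r (i (lpos j)) * t (i (lpos j)) (i (rpos j))) •
            (∑ d ∈ Finset.range ((-(cB B (i (lpos j)) (i (rpos j))) - 1).toNat + 1),
              Xf 𝕜 J n (lpos j) ^ d
                * Xf 𝕜 J n (rpos k) ^ ((-(cB B (i (lpos j)) (i (rpos j))) - 1).toNat - d)
                * Ef 𝕜 J n i)
          + r (i (lpos j)) •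
            (∑ p ∈ Finset.range (sBound B (i (lpos j)) (i (rpos j))),
             ∑ q ∈ Finset.range (sBound B (i (lpos j)) (i (rpos j))),
              s (i (lpos j)) (i (rpos j)) p q •
                ∑ k1 ∈ Finset.range p,
                  Xf 𝕜 J n (lpos j) ^ k1 * Xf 𝕜 J n (rpos j) ^ q
                    * Xf 𝕜 J n (rpos k) ^ (p - 1 - k1) * Ef 𝕜 J n i)
         else 0)

/-- The KLR algebra `R_n` on `n` strands. -/
abbrev KLRAlg (𝕜 : Type) [Field 𝕜] (J : Type) [Fintype J] (n : ℕ)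
    (B : J → J → ℤ) (t : J → J → 𝕜) (r : J → 𝕜) (s : J → J → ℕ → ℕ → 𝕜) :=
  RingQuot (KLRRel 𝕜 J n B t r s)

/-- The canonical map from the free algebra to the KLR algebra. -/
def klrMk (𝕜 : Type) [Field 𝕜] (J : Type) [Fintype J] (n : ℕ)
    (B : J → J → ℤ) (t : J → J → 𝕜) (r : J → 𝕜) (s : J → J → ℕ → ℕ → 𝕜) :
    FreeAlgebra 𝕜 (KLRGen J n) →ₐ[𝕜] KLRAlg 𝕜 J n B t r s :=
  RingQuot.mkAlgHom 𝕜 (KLRRel 𝕜 J n B t r s)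

/-- The idempotent `e(𝐢)` in the KLR algebra. -/
def eQ (𝕜 : Type) [Field 𝕜] (J : Type) [Fintype J] (n : ℕ)
    (B : J → J → ℤ) (t : J → J → 𝕜) (r : J → 𝕜) (s : J → J → ℕ → ℕ → 𝕜)
    (i : Fin n → J) : KLRAlg 𝕜 J n B t r s :=
  klrMk 𝕜 J n B t r s (Ef 𝕜 J n i)

/-- The dot `x_j` in the KLR algebra. -/
def xQ (𝕜 : Type) [Field 𝕜] (J : Type) [Fintype J] (n : ℕ)
    (B : J → J → ℤ) (t : J → J → 𝕜) (r : J → 𝕜) (s : J → J → ℕ → ℕ → 𝕜)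
    (j : Fin n) : KLRAlg 𝕜 J n B t r s :=
  klrMk 𝕜 J n B t r s (Xf 𝕜 J n j)

/-- The crossing `ψ_j` in the KLR algebra. -/
def pQ (𝕜 : Type) [Field 𝕜] (J : Type) [Fintype J] (n : ℕ)
    (B : J → J → ℤ) (t : J → J → 𝕜) (r : J → 𝕜) (s : J → J → ℕ → ℕ → 𝕜)
    (j : Fin (n - 1)) : KLRAlg 𝕜 J n B t r s :=
  klrMk 𝕜 J n B t r s (Pf 𝕜 J n j)


section Extended

/-- The list of block labels of the thick strand: the label `i` appears with
multiplicity `λ^{(i)}`, in increasing order of `i`. -/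
def blockList (N : ℕ) (lam : Fin N → ℕ) : List (Fin N) :=
  (List.finRange N).flatMap (fun i => List.replicate (lam i) i)

/-- `m = Σ_i λ^{(i)}`, the total number of dashed strands of the thick strand. -/
def mTot (N : ℕ) (lam : Fin N → ℕ) : ℕ := (blockList N lam).length

/-- The block containing the strand position `l`. -/
def blockOf (N : ℕ) (lam : Fin N → ℕ) (l : Fin (mTot N lam)) : Fin N :=
  (blockList N lam).get l

/-- `psum i = Σ_{a < i} λ^{(a)}`, the starting position of the `i`-th block. -/
def psum (N : ℕ) (lam : Fin N → ℕ) (i : Fin N) : ℕ :=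
  ∑ a : Fin N, if a.val < i.val then lam a else 0

/-- The sequence `μ̄ ∈ Ī^m` listing each `ī` with multiplicity `λ^{(i)}`, in
increasing order of `i`. -/
def mubar (N : ℕ) (lam : Fin N → ℕ) : Fin (mTot N lam) → Fin N ⊕ Fin N :=
  fun l => Sum.inr (blockOf N lam l)

/-- The standard reduced word `s_1 (s_2 s_1) ⋯ (s_{a−1} ⋯ s_1)` (0-indexed) of the
longest element `w_0` of `𝔖_a`. -/
def w0Word (a : ℕ) : List ℕ :=
  (List.range a).flatMap (fun k => (List.range k).reverse)

/-- The KLR algebra `R_n(Q̄_{C̃})` of the extended Cartan datum of `C` with the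
specialized scalar parameters: `r ≡ 1`, `s ≡ 0` and `t` as given. -/
abbrev ExtKLR (𝕜 : Type) [Field 𝕜] (N : ℕ) (C : CartanDatum (Fin N))
    (t : Fin N ⊕ Fin N → Fin N ⊕ Fin N → 𝕜) (n : ℕ) :=
  KLRAlg 𝕜 (Fin N ⊕ Fin N) n (extForm C) t (fun _ => 1) (fun _ _ _ _ => 0)

/-- The dot `x_l` (0-indexed position `l`, junk value `1` if `l ≥ n`). -/
def Xn (𝕜 : Type) [Field 𝕜] (N : ℕ) (C : CartanDatum (Fin N))
    (t : Fin N ⊕ Fin N → Fin N ⊕ Fin N → 𝕜) (n : ℕ) (l : ℕ) :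
    ExtKLR 𝕜 N C t n :=
  if h : l < n then
    xQ 𝕜 (Fin N ⊕ Fin N) n (extForm C) t (fun _ => 1) (fun _ _ _ _ => 0) ⟨l, h⟩
  else 1

/-- The crossing `ψ_l` of the strands at 0-indexed positions `l, l+1`
(junk value `1` if `l ≥ n − 1`). -/
def Pn (𝕜 : Type) [Field 𝕜] (N : ℕ) (C : CartanDatum (Fin N))
    (t : Fin N ⊕ Fin N → Fin N ⊕ Fin N → 𝕜) (n : ℕ) (l : ℕ) :
    ExtKLR 𝕜 N C t n :=
  if h : l < n - 1 then
    pQ 𝕜 (Fin N ⊕ Fin N) n (extForm C) t (fun _ => 1) (fun _ _ _ _ => 0) ⟨l, h⟩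
  else 1

/-- The idempotent `e(𝐢)` of `R_n(Q̄_{C̃})`. -/
def eS (𝕜 : Type) [Field 𝕜] (N : ℕ) (C : CartanDatum (Fin N))
    (t : Fin N ⊕ Fin N → Fin N ⊕ Fin N → 𝕜) (n : ℕ)
    (i : Fin n → Fin N ⊕ Fin N) : ExtKLR 𝕜 N C t n :=
  eQ 𝕜 (Fin N ⊕ Fin N) n (extForm C) t (fun _ => 1) (fun _ _ _ _ => 0) i

/-- The nilHecke idempotent `e_a = x_1^{a−1} ⋯ x_{a−1} ψ_{w_0}` written in the
generators attached to the `a` consecutive strand positions `o, o+1, …, o+a−1`. -/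
def enAt (𝕜 : Type) [Field 𝕜] (N : ℕ) (C : CartanDatum (Fin N))
    (t : Fin N ⊕ Fin N → Fin N ⊕ Fin N → 𝕜) (n o a : ℕ) :
    ExtKLR 𝕜 N C t n :=
  (((List.range a).map (fun d => Xn 𝕜 N C t n (o + d) ^ (a - 1 - d))).prod) *
  (((w0Word a).map (fun l => Pn 𝕜 N C t n (o + l))).prod)

/-- The product `Π_{i ∈ I} e_{λ^{(i)}}` of nilHecke idempotents, the `i`-th one
written in the generators of the `i`-th block of strand positions, the thick
strand occupying the positions `o, o+1, …, o+m−1`. -/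
def nilProd (𝕜 : Type) [Field 𝕜] (N : ℕ) (C : CartanDatum (Fin N))
    (t : Fin N ⊕ Fin N → Fin N ⊕ Fin N → 𝕜) (lam : Fin N → ℕ) (n o : ℕ) :
    ExtKLR 𝕜 N C t n :=
  ((List.finRange N).map (fun i => enAt 𝕜 N C t n (o + psum N lam i) (lam i))).prod

/-- The thick idempotent `e_{λ} = e(μ̄) Π_i e_{λ^{(i)}} ∈ R_m(Q̄_{C̃})`. -/
def thickE (𝕜 : Type) [Field 𝕜] (N : ℕ) (C : CartanDatum (Fin N))
    (t : Fin N ⊕ Fin N → Fin N ⊕ Fin N → 𝕜) (lam : Fin N → ℕ) :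
    ExtKLR 𝕜 N C t (mTot N lam) :=
  eS 𝕜 N C t (mTot N lam) (mubar N lam) * nilProd 𝕜 N C t lam (mTot N lam) 0

/-- The `d`-th elementary symmetric polynomial in the dots `x_l`, `l ∈ S`. -/
def esymAt (𝕜 : Type) [Field 𝕜] (N : ℕ) (C : CartanDatum (Fin N))
    (t : Fin N ⊕ Fin N → Fin N ⊕ Fin N → 𝕜) (n d : ℕ) (S : Finset ℕ) :
    ExtKLR 𝕜 N C t n :=
  ∑ T ∈ S.powersetCard d, ((T.sort (· ≤ ·)).map (Xn 𝕜 N C t n)).prod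

/-- The set of strand positions of the `i`-th block of the thick strand, when the
thick strand occupies the positions `o, o+1, …, o+m−1`. -/
def blkSet (N : ℕ) (lam : Fin N → ℕ) (o : ℕ) (i : Fin N) : Finset ℕ :=
  Finset.Ico (o + psum N lam i) (o + psum N lam i + lam i)

end Extended


section TwoSolid

variable (𝕜 : Type) [Field 𝕜] (N : ℕ) (C : CartanDatum (Fin N))
  (t : Fin N ⊕ Fin N → Fin N ⊕ Fin N → 𝕜) (lam : Fin N → ℕ)

/-- The idempotent `E = e((μ̄,i,j))·e_{λ_k}` of `R_{m+2}(Q̄_{C̃})`, the thick strand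
occupying positions `1,…,m`. -/
def Eend (i j : Fin N) : ExtKLR 𝕜 N C t (mTot N lam + 2) :=
  eS 𝕜 N C t (mTot N lam + 2)
      (Fin.snoc (Fin.snoc (mubar N lam) (Sum.inl i)) (Sum.inl j)) *
    nilProd 𝕜 N C t lam (mTot N lam + 2) 0

/-- The idempotent `E' = e((j,i,μ̄))·e_{λ_k}` of `R_{m+2}(Q̄_{C̃})`, the thick strand
occupying positions `3,…,m+2`. -/
def Eend' (i j : Fin N) : ExtKLR 𝕜 N C t (mTot N lam + 2) :=
  eS 𝕜 N C t (mTot N lam + 2)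
      (Fin.cons (Sum.inl j) (Fin.cons (Sum.inl i) (mubar N lam))) *
    nilProd 𝕜 N C t lam (mTot N lam + 2) 2

/-- `ψ_1 ψ_2 ⋯ ψ_m` in `R_{m+2}(Q̄_{C̃})`. -/
def psiUp2 : ExtKLR 𝕜 N C t (mTot N lam + 2) :=
  ((List.range (mTot N lam)).map (Pn 𝕜 N C t (mTot N lam + 2))).prod

/-- `ψ_2 ψ_3 ⋯ ψ_{m+1}` in `R_{m+2}(Q̄_{C̃})`. -/
def psiUp2' : ExtKLR 𝕜 N C t (mTot N lam + 2) :=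
  ((List.range (mTot N lam)).map (fun l => Pn 𝕜 N C t (mTot N lam + 2) (l + 1))).prod

/-- `ψ_m ψ_{m−1} ⋯ ψ_1` in `R_{m+2}(Q̄_{C̃})`. -/
def psiDown2 : ExtKLR 𝕜 N C t (mTot N lam + 2) :=
  ((List.range (mTot N lam)).reverse.map (Pn 𝕜 N C t (mTot N lam + 2))).prod

/-- `ψ_{m+1} ψ_m ⋯ ψ_2` in `R_{m+2}(Q̄_{C̃})`. -/
def psiDown2' : ExtKLR 𝕜 N C t (mTot N lam + 2) :=
  ((List.range (mTot N lam)).reverse.map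
    (fun l => Pn 𝕜 N C t (mTot N lam + 2) (l + 1))).prod

end TwoSolid

section Crossings

variable {𝕜 : Type} [Field 𝕜] {N : ℕ} {C : CartanDatum (Fin N)}
  {t : Fin N ⊕ Fin N → Fin N ⊕ Fin N → 𝕜} {n : ℕ}

theorem Pn_commute {l l' : ℕ} (h : l + 1 < l') :
    Commute (Pn 𝕜 N C t n l) (Pn 𝕜 N C t n l') := by
  unfold Pn
  split_ifs with h₁ h₂
  · have key := RingQuot.mkAlgHom_rel 𝕜 (KLRRel.psipsi (B := extForm C) (t := t)
      (r := fun _ => 1) (s := fun _ _ _ _ => 0) ⟨l, h₁⟩ ⟨l', h₂⟩ h)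
    rw [map_mul, map_mul] at key
    exact key
  · exact Commute.one_right _
  · exact Commute.one_left _
  · exact Commute.one_left _

theorem Pn_mul_eS {l : ℕ} (h : l + 1 < n) (s : Fin n → Fin N ⊕ Fin N) :
    Pn 𝕜 N C t n l * eS 𝕜 N C t n s =
      eS 𝕜 N C t n (s ∘ Equiv.swap ⟨l, by omega⟩ ⟨l + 1, h⟩) * Pn 𝕜 N C t n l := by
  have hl : l < n - 1 := by omega
  have key := RingQuot.mkAlgHom_rel 𝕜 (KLRRel.psie (B := extForm C) (t := t)
    (r := fun _ => 1) (s := fun _ _ _ _ => 0) ⟨l, hl⟩ s)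
  rw [map_mul, map_mul] at key
  rw [Pn, dif_pos hl]
  exact key

/-- The braid relation has no correction term when the outer two strands carry
different labels. -/
theorem Pn_braid {l : ℕ} (h : l + 2 < n) (s : Fin n → Fin N ⊕ Fin N)
    (hs : s ⟨l, by omega⟩ ≠ s ⟨l + 2, h⟩) :
    Pn 𝕜 N C t n l * Pn 𝕜 N C t n (l + 1) * Pn 𝕜 N C t n l * eS 𝕜 N C t n s =
      Pn 𝕜 N C t n (l + 1) * Pn 𝕜 N C t n l * Pn 𝕜 N C t n (l + 1) * eS 𝕜 N C t n s := by
  have h₁ : l < n - 1 := by omega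
  have h₂ : l + 1 < n - 1 := by omega
  have key := RingQuot.mkAlgHom_rel 𝕜 (KLRRel.braid (B := extForm C) (t := t)
    (r := fun _ => 1) (s := fun _ _ _ _ => 0) ⟨l, h₁⟩ ⟨l + 1, h₂⟩ rfl s)
  rw [if_neg (fun hc => hs hc.1), map_zero, map_sub, sub_eq_zero] at key
  simp only [map_mul] at key
  rw [Pn, Pn, dif_pos h₁, dif_pos h₂]
  exact key

/-- Moving the strands at positions `k` and `k + 1` to the left across the first `k`
strands commutes with crossing them. -/
theorem Pn_braid_ascending (k : ℕ) (hk : k + 1 < n) (s : Fin n → Fin N ⊕ Fin N)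
    (hs : ∀ l : Fin n, l.val < k → s l ≠ s ⟨k + 1, hk⟩) :
    Pn 𝕜 N C t n 0 * ((List.range k).map (fun l => Pn 𝕜 N C t n (l + 1))).prod
        * ((List.range k).map (Pn 𝕜 N C t n)).prod * eS 𝕜 N C t n s =
      ((List.range k).map (fun l => Pn 𝕜 N C t n (l + 1))).prod
        * ((List.range k).map (Pn 𝕜 N C t n)).prod * Pn 𝕜 N C t n k * eS 𝕜 N C t n s := by
  induction k generalizing s with
  | zero => simp
  | succ k ih =>
    have hcomm : Commute (Pn 𝕜 N C t n (k + 1)) ((List.range k).map (Pn 𝕜 N C t n)).prod := by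
      refine Commute.list_prod_right _ _ fun y hy => ?_
      obtain ⟨l, hl, rfl⟩ := List.mem_map.1 hy
      exact (Pn_commute (by simpa using hl)).symm
    simp only [List.range_succ, List.map_append, List.map_singleton, List.prod_append,
      List.prod_singleton]
    set p := Pn 𝕜 N C t n
    set A := ((List.range k).map (fun l => p (l + 1))).prod
    set B := ((List.range k).map p).prod
    set s₁ := s ∘ Equiv.swap (⟨k, by omega⟩ : Fin n) ⟨k + 1, by omega⟩ with hs₁
    set s₂ := s₁ ∘ Equiv.swap (⟨k + 1, by omega⟩ : Fin n) ⟨k + 2, by omega⟩ with hs₂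
    have he : p (k + 1) * p k * eS 𝕜 N C t n s = eS 𝕜 N C t n s₂ * (p (k + 1) * p k) := by
      rw [mul_assoc, Pn_mul_eS (l := k) (by omega), ← mul_assoc,
        Pn_mul_eS (l := k + 1) (by omega), mul_assoc]
    have hs' : ∀ l : Fin n, l.val < k → s₂ l ≠ s₂ ⟨k + 1, by omega⟩ := by
      intro l hl
      have e₁ : s₂ l = s l := by
        simp only [hs₂, hs₁, Function.comp_apply]
        rw [Equiv.swap_apply_of_ne_of_ne (x := l), Equiv.swap_apply_of_ne_of_ne] <;>
          (rw [Ne, Fin.ext_iff]; simp only; omega)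
      have e₂ : s₂ ⟨k + 1, by omega⟩ = s ⟨k + 2, by omega⟩ := by
        simp only [hs₂, hs₁, Function.comp_apply, Equiv.swap_apply_left]
        rw [Equiv.swap_apply_of_ne_of_ne] <;> simp [Fin.ext_iff]
      rw [e₁, e₂]
      exact hs l (by omega)
    calc p 0 * (A * p (k + 1)) * (B * p k) * eS 𝕜 N C t n s
        = p 0 * A * (p (k + 1) * B) * p k * eS 𝕜 N C t n s := by simp only [mul_assoc]
      _ = p 0 * A * B * (p (k + 1) * p k * eS 𝕜 N C t n s) := by
          rw [hcomm.eq]; simp only [mul_assoc]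
      _ = p 0 * A * B * eS 𝕜 N C t n s₂ * (p (k + 1) * p k) := by
          rw [he]; simp only [mul_assoc]
      _ = A * B * p k * (eS 𝕜 N C t n s₂ * (p (k + 1) * p k)) := by
          rw [ih (by omega) s₂ hs']; simp only [mul_assoc]
      _ = A * B * (p k * p (k + 1) * p k * eS 𝕜 N C t n s) := by
          rw [← he]; simp only [mul_assoc]
      _ = A * (B * p (k + 1)) * p k * p (k + 1) * eS 𝕜 N C t n s := by
          rw [Pn_braid (l := k) (by omega) s (hs _ (by simp))]; simp only [p, mul_assoc]
      _ = A * p (k + 1) * (B * p k) * p (k + 1) * eS 𝕜 N C t n s := by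
          rw [← hcomm.eq]; simp only [mul_assoc]

/-- Moving the strands at positions `a` and `a + 1` to the right across the next `k`
strands commutes with crossing them. -/
theorem Pn_braid_descending (k a : ℕ) (hk : a + k + 1 < n) (s : Fin n → Fin N ⊕ Fin N)
    (hs : ∀ l : Fin n, a + 1 < l.val → s ⟨a, by omega⟩ ≠ s l) :
    Pn 𝕜 N C t n (a + k) * ((List.range k).reverse.map (fun l => Pn 𝕜 N C t n (l + a))).prod
        * ((List.range k).reverse.map (fun l => Pn 𝕜 N C t n (l + (a + 1)))).prod
        * eS 𝕜 N C t n s =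
      ((List.range k).reverse.map (fun l => Pn 𝕜 N C t n (l + a))).prod
        * ((List.range k).reverse.map (fun l => Pn 𝕜 N C t n (l + (a + 1)))).prod
        * Pn 𝕜 N C t n a * eS 𝕜 N C t n s := by
  induction k generalizing a s with
  | zero => simp
  | succ k ih =>
    have hcomm : Commute (Pn 𝕜 N C t n a)
        ((List.range k).reverse.map (fun l => Pn 𝕜 N C t n (l + (a + 1 + 1)))).prod := by
      refine Commute.list_prod_right _ _ fun y hy => ?_
      obtain ⟨l, hl, rfl⟩ := List.mem_map.1 hy
      exact Pn_commute (by omega)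
    have hsplit : ∀ b : ℕ, ((List.range (k + 1)).reverse.map (fun l => Pn 𝕜 N C t n (l + b))).prod
        = ((List.range k).reverse.map (fun l => Pn 𝕜 N C t n (l + (b + 1)))).prod
          * Pn 𝕜 N C t n b := by
      intro b
      simp [List.range_succ_eq_map, Function.comp_def, add_assoc, add_comm 1]
    have ih' := ih (a + 1)
    rw [hsplit, hsplit, show a + (k + 1) = a + 1 + k by omega]
    set p := Pn 𝕜 N C t n
    set A := ((List.range k).reverse.map (fun l => p (l + (a + 1)))).prod
    set B := ((List.range k).reverse.map (fun l => p (l + (a + 1 + 1)))).prod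
    set s₁ := s ∘ Equiv.swap (⟨a + 1, by omega⟩ : Fin n) ⟨a + 2, by omega⟩ with hs₁
    set s₂ := s₁ ∘ Equiv.swap (⟨a, by omega⟩ : Fin n) ⟨a + 1, by omega⟩ with hs₂
    have he : p a * p (a + 1) * eS 𝕜 N C t n s = eS 𝕜 N C t n s₂ * (p a * p (a + 1)) := by
      rw [mul_assoc, Pn_mul_eS (l := a + 1) (by omega), ← mul_assoc,
        Pn_mul_eS (l := a) (by omega), mul_assoc]
    have hs' : ∀ l : Fin n, a + 1 + 1 < l.val → s₂ ⟨a + 1, by omega⟩ ≠ s₂ l := by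
      intro l hl
      have e₁ : s₂ l = s l := by
        simp only [hs₂, hs₁, Function.comp_apply]
        rw [Equiv.swap_apply_of_ne_of_ne (x := l), Equiv.swap_apply_of_ne_of_ne] <;>
          (rw [Ne, Fin.ext_iff]; simp only; omega)
      have e₂ : s₂ ⟨a + 1, by omega⟩ = s ⟨a, by omega⟩ := by
        simp only [hs₂, hs₁, Function.comp_apply, Equiv.swap_apply_right]
        rw [Equiv.swap_apply_of_ne_of_ne] <;> simp [Fin.ext_iff]
      rw [e₁, e₂]
      exact hs l (by omega)
    calc p (a + 1 + k) * (A * p a) * (B * p (a + 1)) * eS 𝕜 N C t n s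
        = p (a + 1 + k) * A * (p a * B) * p (a + 1) * eS 𝕜 N C t n s := by
          simp only [mul_assoc]
      _ = p (a + 1 + k) * A * B * (p a * p (a + 1) * eS 𝕜 N C t n s) := by
          rw [hcomm.eq]; simp only [mul_assoc]
      _ = p (a + 1 + k) * A * B * eS 𝕜 N C t n s₂ * (p a * p (a + 1)) := by
          rw [he]; simp only [mul_assoc]
      _ = A * B * p (a + 1) * (eS 𝕜 N C t n s₂ * (p a * p (a + 1))) := by
          rw [ih' (by omega) s₂ hs']; simp only [mul_assoc]
      _ = A * B * (p (a + 1) * p a * p (a + 1) * eS 𝕜 N C t n s) := by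
          rw [← he]; simp only [mul_assoc]
      _ = A * (B * p a) * p (a + 1) * p a * eS 𝕜 N C t n s := by
          rw [← Pn_braid (l := a) (by omega) s (hs _ (by simp))]; simp only [p, mul_assoc]
      _ = A * p a * (B * p (a + 1)) * p a * eS 𝕜 N C t n s := by
          rw [← hcomm.eq]; simp only [mul_assoc]

end Crossings

/-- braid relation with the thick strand at an end, in `R_{m+2}(Q̄_{C̃})`:
(a) `ψ_1 (ψ_2⋯ψ_{m+1}) (ψ_1⋯ψ_m) E = (ψ_2⋯ψ_{m+1}) (ψ_1⋯ψ_m) ψ_{m+1} E`;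
(b) `ψ_{m+1} (ψ_m⋯ψ_1) (ψ_{m+1}⋯ψ_2) E' = (ψ_m⋯ψ_1) (ψ_{m+1}⋯ψ_2) ψ_1 E'`. -/
theorem braid_with_thick_strand_at_end
    (𝕜 : Type) [Field 𝕜] (N : ℕ) (C : CartanDatum (Fin N))
    (t : Fin N ⊕ Fin N → Fin N ⊕ Fin N → 𝕜)
    (ht0 : ∀ a b, t a b ≠ 0)
    (ht1 : ∀ k : Fin N, t (Sum.inr k) (Sum.inl k) = -1)
    (ht2 : ∀ k : Fin N, t (Sum.inl k) (Sum.inr k) = 1)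
    (ht3 : ∀ a b, extForm C a b = 0 → t a b = 1)
    (ht4 : ∀ a, t a a = 1)
    (lam : Fin N → ℕ) (i j : Fin N) :
    (Pn 𝕜 N C t (mTot N lam + 2) 0 * psiUp2' 𝕜 N C t lam * psiUp2 𝕜 N C t lam
          * Eend 𝕜 N C t lam i j
        = psiUp2' 𝕜 N C t lam * psiUp2 𝕜 N C t lam
            * Pn 𝕜 N C t (mTot N lam + 2) (mTot N lam) * Eend 𝕜 N C t lam i j) ∧
    (Pn 𝕜 N C t (mTot N lam + 2) (mTot N lam) * psiDown2 𝕜 N C t lam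
          * psiDown2' 𝕜 N C t lam * Eend' 𝕜 N C t lam i j
        = psiDown2 𝕜 N C t lam * psiDown2' 𝕜 N C t lam
            * Pn 𝕜 N C t (mTot N lam + 2) 0 * Eend' 𝕜 N C t lam i j) := by
  constructor
  · have key := Pn_braid_ascending (𝕜 := 𝕜) (C := C) (t := t) (n := mTot N lam + 2)
      (mTot N lam) (by omega)
      (Fin.snoc (Fin.snoc (mubar N lam) (Sum.inl i)) (Sum.inl j)) (by
        intro l hl
        obtain ⟨l, rfl⟩ : ∃ l' : Fin (mTot N lam), l = l'.castSucc.castSucc := ⟨⟨l, hl⟩, rfl⟩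
        rw [show (⟨mTot N lam + 1, _⟩ : Fin (mTot N lam + 2)) = Fin.last _ from rfl,
          Fin.snoc_castSucc (α := fun _ => Fin N ⊕ Fin N), Fin.snoc_last,
          Fin.snoc_castSucc (α := fun _ => Fin N ⊕ Fin N)]
        simp [mubar])
    unfold psiUp2 psiUp2' Eend
    rw [← mul_assoc, ← mul_assoc, key]
  · have key := Pn_braid_descending (𝕜 := 𝕜) (C := C) (t := t) (n := mTot N lam + 2)
      (mTot N lam) 0 (by omega)
      (Fin.cons (Sum.inl j) (Fin.cons (Sum.inl i) (mubar N lam))) (by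
        intro l hl
        obtain ⟨l, rfl⟩ : ∃ l' : Fin (mTot N lam), l = l'.succ.succ :=
          ⟨⟨l - 2, by omega⟩, by rw [Fin.ext_iff]; simp only [Fin.val_succ]; omega⟩
        rw [show (⟨0, _⟩ : Fin (mTot N lam + 2)) = 0 from rfl, Fin.cons_zero, Fin.cons_succ,
          Fin.cons_succ]
        simp [mubar])
    simp only [zero_add, add_zero] at key
    unfold psiDown2 psiDown2' Eend'
    rw [← mul_assoc, ← mul_assoc]
    exact congrArg (· * nilProd 𝕜 N C t lam (mTot N lam + 2) 2) key


end
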